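/- Let m be a universal semimeasure with a fixed approximation (m_t) from below, and for computable f : ℕ → ℕ and g : List Bool × ℕ → ℕ define e_{f,g}(x) = |x|/(log |x|)⁵ if for every t either m_{f(t)}(t) ≤ 6·log|x| / |x| or m_{g(x,t)}(x) ≥ 2·m_t(x), and e_{f,g}(x) = 1 otherwise (here m_s(t) denotes m_s at the string of t zeros). Then there exist a computable f and a constant C > 0 such that for every computable g and every n ≥ 2: ∑' over {x : |x| = n and e_{f,g}(x) > 1} of m(x) is at most C · (log n)³ / n. -/

import Mathlib

open scoped ENNReal NNReal

/-- Interpret a rational approximation value as an extended nonnegative real. -/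
noncomputable def qval (q : ℚ) : ℝ≥0∞ := ENNReal.ofReal q

/-- Interpret a value in `ℚ≥0 ∪ {∞}` (with nonnegativity required separately)
as an extended nonnegative real; `none` stands for `∞`. -/
noncomputable def qtval (q : Option ℚ) : ℝ≥0∞ := q.elim ⊤ (fun a => ENNReal.ofReal a)

/-- A (discrete) semimeasure on bitstrings. -/
def IsSemimeasure (P : List Bool → ℝ≥0∞) : Prop := ∑' x, P x ≤ 1

/-- `Ps` is a computable approximation of `P` from below (by nonnegative rationals,
nondecreasing in the stage). -/
def IsApproxFromBelow (P : List Bool → ℝ≥0∞) (Ps : List Bool → ℕ → ℚ) : Prop :=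
  Computable (fun p : List Bool × ℕ => Ps p.1 p.2) ∧
  (∀ x s, 0 ≤ Ps x s) ∧
  (∀ x, Monotone fun s => Ps x s) ∧
  (∀ x, P x = ⨆ s, qval (Ps x s))

/-- `P` is lower semicomputable. -/
def LowerSemicomputable (P : List Bool → ℝ≥0∞) : Prop := ∃ Ps, IsApproxFromBelow P Ps

/-- `es` is a computable approximation of `e` from above (by values in `ℚ≥0 ∪ {∞}`,
nonincreasing in the stage). -/
def IsApproxFromAbove (e : List Bool → ℝ≥0∞) (es : List Bool → ℕ → Option ℚ) : Prop :=
  Computable (fun p : List Bool × ℕ => es p.1 p.2) ∧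
  (∀ x s, ∀ a ∈ es x s, (0:ℚ) ≤ a) ∧
  (∀ x, Antitone fun s => qtval (es x s)) ∧
  (∀ x, e x = ⨅ s, qtval (es x s))

/-- `e` is upper semicomputable. -/
def UpperSemicomputable (e : List Bool → ℝ≥0∞) : Prop := ∃ es, IsApproxFromAbove e es

/-- `e` is a sumtest for the semimeasure `P`. -/
def IsSumtest (P e : List Bool → ℝ≥0∞) : Prop := ∑' x, P x * e x ≤ 1

/-- `m` is a universal (lower semicomputable) semimeasure. -/
def IsUniversalSemimeasure (m : List Bool → ℝ≥0∞) : Prop :=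
  IsSemimeasure m ∧ LowerSemicomputable m ∧
  ∀ P, IsSemimeasure P → LowerSemicomputable P → ∃ c : ℝ≥0, 0 < c ∧ ∀ x, P x ≤ c * m x

/-- A conditional semimeasure `m(·|·)`. -/
def IsCondSemimeasure (m : List Bool → ℕ → ℝ≥0∞) : Prop := ∀ s, ∑' x, m x s ≤ 1

/-- `ms` is a computable approximation from below of the conditional semimeasure `m`:
`ms t x s` approximates `m(x|s)`, nondecreasing in the stage `t`. -/
def IsCondApproxFromBelow (m : List Bool → ℕ → ℝ≥0∞) (ms : ℕ → List Bool → ℕ → ℚ) : Prop :=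
  Computable (fun p : ℕ × List Bool × ℕ => ms p.1 p.2.1 p.2.2) ∧
  (∀ t x s, 0 ≤ ms t x s) ∧
  (∀ x s, Monotone fun t => ms t x s) ∧
  (∀ x s, m x s = ⨆ t, qval (ms t x s))

/-- The conditional semimeasure `m` is lower semicomputable (jointly). -/
def CondLowerSemicomputable (m : List Bool → ℕ → ℝ≥0∞) : Prop :=
  ∃ ms, IsCondApproxFromBelow m ms

/-- `m(·|·)` is a universal lower semicomputable conditional semimeasure. -/
def IsUniversalCondSemimeasure (m : List Bool → ℕ → ℝ≥0∞) : Prop :=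
  IsCondSemimeasure m ∧ CondLowerSemicomputable m ∧
  ∀ m', IsCondSemimeasure m' → CondLowerSemicomputable m' →
    ∃ c : ℝ≥0, 0 < c ∧ ∀ x s, m' x s ≤ c * m x s

/-- The string consisting of `t` zeros, representing the natural number `t`. -/
def zeros (t : ℕ) : List Bool := List.replicate t false

open scoped Classical in
/-- The test `e_{f,g}`: it equals `|x|/(log |x|)⁵` if for every `t` either
`m_{f(t)}(t) ≤ 6 log|x| / |x|` or `m_{g(x,t)}(x) ≥ 2 m_t(x)`, and `1` otherwise. -/
noncomputable def etest (mt : List Bool → ℕ → ℚ) (f : ℕ → ℕ) (g : List Bool × ℕ → ℕ)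
    (x : List Bool) : ℝ≥0∞ :=
  if ∀ t : ℕ,
      qval (mt (zeros t) (f t)) ≤
          ENNReal.ofReal (6 * Real.logb 2 x.length / x.length) ∨
      2 * qval (mt x t) ≤ qval (mt x (g (x, t)))
  then ENNReal.ofReal (x.length / (Real.logb 2 x.length) ^ 5)
  else 1

section RationalCodes

open Encodable

/-- The code of a rational number as the pair of the codes of its numerator and denominator. -/
def ratPairCode (q : ℚ) : ℕ := Nat.pair (encode q.num) q.den

theorem ratPairCode_injective : Function.Injective ratPairCode :=
  @encode_injective ℚ Rat.instEncodable

theorem encode_natCast_int (n : ℕ) : encode (n : ℤ) = 2 * n := rfl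

theorem encode_negSucc_int (n : ℕ) : encode (Int.negSucc n) = 2 * n + 1 := rfl

theorem Int.natAbs_eq_encode (z : ℤ) : z.natAbs = (encode z + 1) / 2 := by
  rcases z with n | n
  · have : encode (Int.ofNat n) = 2 * n := rfl
    rw [this]
    simp only [Int.ofNat_eq_natCast, Int.natAbs_natCast]
    omega
  · rw [encode_negSucc_int, Int.natAbs_negSucc]
    omega

theorem mem_range_ratPairCode (k : ℕ) :
    k ∈ Set.range ratPairCode ↔
      0 < k.unpair.2 ∧ ((k.unpair.1 + 1) / 2).Coprime k.unpair.2 := by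
  constructor
  · rintro ⟨q, rfl⟩
    simp only [ratPairCode, Nat.unpair_pair, ← Int.natAbs_eq_encode]
    exact ⟨q.den_pos, q.reduced⟩
  · rintro ⟨h1, h2⟩
    obtain ⟨z, hz⟩ : ∃ z : ℤ, encode z = k.unpair.1 :=
      ⟨Denumerable.ofNat ℤ k.unpair.1, Denumerable.encode_ofNat _⟩
    rw [← hz, ← Int.natAbs_eq_encode] at h2
    refine ⟨⟨z, k.unpair.2, h1.ne', h2⟩, ?_⟩
    simp [ratPairCode, hz]

theorem PrimrecRel.nat_coprime : PrimrecRel Nat.Coprime := by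
  have hdiv : PrimrecRel fun (d : ℕ) (p : ℕ × ℕ) => p.1 % d = 0 ∧ p.2 % d = 0 → d = 1 := by
    have h1 : PrimrecPred fun x : ℕ × (ℕ × ℕ) => x.2.1 % x.1 = 0 :=
      Primrec.eq.comp (Primrec.nat_mod.comp (Primrec.fst.comp Primrec.snd) Primrec.fst)
        (Primrec.const 0)
    have h2 : PrimrecPred fun x : ℕ × (ℕ × ℕ) => x.2.2 % x.1 = 0 :=
      Primrec.eq.comp (Primrec.nat_mod.comp (Primrec.snd.comp Primrec.snd) Primrec.fst)
        (Primrec.const 0)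
    have h3 : PrimrecPred fun x : ℕ × (ℕ × ℕ) => x.1 = 1 :=
      Primrec.eq.comp Primrec.fst (Primrec.const 1)
    exact ((h1.and h2).not.or h3).of_eq fun x => by tauto
  have hlist := hdiv.forall_mem_list.comp
    (f := fun p : ℕ × ℕ => List.range (p.1 + p.2 + 1)) (g := fun p => p)
    (Primrec.list_range.comp (Primrec.succ.comp (Primrec.nat_add.comp Primrec.fst Primrec.snd)))
    Primrec.id
  have hpos : PrimrecPred fun p : ℕ × ℕ => ¬ (p.1 = 0 ∧ p.2 = 0) :=
    ((Primrec.eq.comp Primrec.fst (Primrec.const 0)).and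
      (Primrec.eq.comp Primrec.snd (Primrec.const 0))).not
  refine (hpos.and hlist).of_eq fun p => ?_
  constructor
  · rintro ⟨h0, h⟩
    have hg : Nat.gcd p.1 p.2 ≤ p.1 + p.2 := by
      rcases Nat.eq_zero_or_pos p.1 with h1 | h1
      · have : 0 < p.2 := by omega
        exact (Nat.le_of_dvd this (Nat.gcd_dvd_right _ _)).trans (by omega)
      · exact (Nat.le_of_dvd h1 (Nat.gcd_dvd_left _ _)).trans (by omega)
    exact h _ (List.mem_range.2 (by omega))
      ⟨Nat.mod_eq_zero_of_dvd (Nat.gcd_dvd_left _ _),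
        Nat.mod_eq_zero_of_dvd (Nat.gcd_dvd_right _ _)⟩
  · intro h
    refine ⟨?_, ?_⟩
    · rintro ⟨h1, h2⟩
      simp [h1, h2] at h
    · rintro d - ⟨h1, h2⟩
      exact Nat.eq_one_of_dvd_coprimes h (Nat.dvd_of_mod_eq_zero h1) (Nat.dvd_of_mod_eq_zero h2)

theorem PrimrecPred.mem_range_ratPairCode : PrimrecPred fun k => k ∈ Set.range ratPairCode := by
  have h1 : PrimrecPred fun k : ℕ => 0 < k.unpair.2 :=
    Primrec.nat_lt.comp (Primrec.const 0) (Primrec.snd.comp Primrec.unpair)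
  have h2 : PrimrecPred fun k : ℕ => ((k.unpair.1 + 1) / 2).Coprime k.unpair.2 :=
    PrimrecRel.nat_coprime.comp
      (Primrec.nat_div.comp (Primrec.succ.comp (Primrec.fst.comp Primrec.unpair))
        (Primrec.const 2))
      (Primrec.snd.comp Primrec.unpair)
  exact (h1.and h2).of_eq fun k => (_root_.mem_range_ratPairCode k).symm

theorem infinite_range_ratPairCode : (Set.range ratPairCode).Infinite :=
  Set.infinite_range_of_injective ratPairCode_injective

theorem exists_add_mem_range_ratPairCode (y : ℕ) : ∃ k, y + k + 1 ∈ Set.range ratPairCode := by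
  obtain ⟨b, hb, hy⟩ := infinite_range_ratPairCode.exists_gt y
  exact ⟨b - y - 1, by rwa [show y + (b - y - 1) + 1 = b by omega]⟩

instance : Infinite (Set.range ratPairCode) := infinite_range_ratPairCode.to_subtype

instance : DecidablePred (· ∈ Set.range ratPairCode) :=
  @Encodable.decidableRangeEncode ℚ Rat.instEncodable

theorem ratPairCode_ofNat (n : ℕ) :
    ratPairCode (Denumerable.ofNat ℚ n) = Nat.Subtype.ofNat (Set.range ratPairCode) n :=
  congrArg Subtype.val ((@equivRangeEncode ℚ Rat.instEncodable).apply_symm_apply _)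

theorem computable_ratPairCode_ofNat :
    Computable fun n => ratPairCode (Denumerable.ofNat ℚ n) := by
  have hmem : ComputablePred fun p : ℕ × ℕ => p.1 + p.2 + 1 ∈ Set.range ratPairCode :=
    (PrimrecPred.mem_range_ratPairCode.comp
      (Primrec.succ.comp (Primrec.nat_add.comp Primrec.fst Primrec.snd))).computablePred
  have hstep : Computable fun y => y + Nat.find (exists_add_mem_range_ratPairCode y) + 1 :=
    Computable.succ.comp (Primrec.nat_add.to_comp.comp Computable.id (Computable.find
      (P := fun y k => y + k + 1 ∈ Set.range ratPairCode) hmem exists_add_mem_range_ratPairCode))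
  have hrec := Computable.nat_rec (f := fun n : ℕ => n)
    (g := fun _ => ((Nat.Subtype.ofNat (Set.range ratPairCode) 0 : Set.range ratPairCode) : ℕ))
    (h := fun _ p => p.2 + Nat.find (exists_add_mem_range_ratPairCode p.2) + 1)
    Computable.id (Computable.const _)
    (hstep.comp (Computable.snd.comp Computable.snd)).to₂
  refine hrec.of_eq fun n => ?_
  rw [ratPairCode_ofNat]
  induction n with
  | zero => rfl
  | succ n ih =>
    simp only at ih ⊢
    rw [ih]
    rfl

theorem computable_ratPairCode : Computable ratPairCode :=
  (computable_ratPairCode_ofNat.comp Computable.encode).of_eq fun q => by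
    rw [Denumerable.ofNat_encode]

theorem Computable.rat_den : Computable Rat.den :=
  (Computable.snd.comp (Computable.unpair.comp computable_ratPairCode)).of_eq fun q => by
    simp [ratPairCode]

theorem Computable.rat_num : Computable Rat.num :=
  Computable.encode_iff.1 <|
    (Computable.fst.comp (Computable.unpair.comp computable_ratPairCode)).of_eq fun q => by
      simp [ratPairCode]

theorem Computable.int_natAbs : Computable Int.natAbs :=
  (Primrec.nat_div.to_comp.comp (Computable.succ.comp Computable.encode)
    (Computable.const 2)).of_eq fun z => (Int.natAbs_eq_encode z).symm

theorem Rat.eq_div_succ_iff (q : ℚ) (a b : ℕ) :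
    q = (a : ℚ) / (b + 1 : ℕ) ↔
      encode q.num % 2 = 0 ∧ encode q.num * (b + 1) = 2 * (a * q.den) := by
  have hb : ((b + 1 : ℕ) : ℚ) ≠ 0 := by positivity
  have hd : (q.den : ℚ) ≠ 0 := by exact_mod_cast q.den_nz
  have key : q = (a : ℚ) / (b + 1 : ℕ) ↔ q.num * ((b + 1 : ℕ) : ℤ) = a * q.den := by
    conv_lhs => rw [← Rat.num_div_den q]
    rw [div_eq_div_iff hd hb]
    exact_mod_cast Iff.rfl
  rw [key]
  rcases hz : q.num with n | n
  · have h : encode (Int.ofNat n) = 2 * n := rfl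
    rw [h, Nat.mul_mod_right, mul_assoc, Int.ofNat_eq_natCast]
    simp only [true_and, Nat.mul_left_cancel_iff two_pos]
    exact_mod_cast Iff.rfl
  · rw [encode_negSucc_int]
    refine iff_of_false (fun h => ?_) (by omega)
    have h1 : Int.negSucc n * ((b + 1 : ℕ) : ℤ) < 0 :=
      mul_neg_of_neg_of_pos (Int.negSucc_lt_zero n) (by positivity)
    have h2 : (0 : ℤ) ≤ a * q.den := by positivity
    omega

/-- A computable search through an enumeration of the rationals finds any given fraction. -/
theorem Computable.natCast_div_succ_of_enumeration {r : ℕ → ℚ} (hr : Computable r)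
    (hsurj : Function.Surjective r) :
    Computable fun p : ℕ × ℕ => (p.1 : ℚ) / (p.2 + 1 : ℕ) := by
  have hex (p : ℕ × ℕ) : ∃ i, r i = (p.1 : ℚ) / (p.2 + 1 : ℕ) := hsurj _
  have hq : Computable fun x : (ℕ × ℕ) × ℕ => r x.2 := hr.comp Computable.snd
  have hnum : Computable fun x : (ℕ × ℕ) × ℕ => encode (r x.2).num :=
    Computable.encode.comp (Computable.rat_num.comp hq)
  have heven : Computable fun x : (ℕ × ℕ) × ℕ => decide (encode (r x.2).num % 2 = 0) :=
    Primrec.eq.decide.to_comp.comp (Primrec.nat_mod.to_comp.comp hnum (Computable.const 2))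
      (Computable.const 0)
  have heq : Computable fun x : (ℕ × ℕ) × ℕ =>
      decide (encode (r x.2).num * (x.1.2 + 1) = 2 * (x.1.1 * (r x.2).den)) :=
    Primrec.eq.decide.to_comp.comp
      (Primrec.nat_mul.to_comp.comp hnum
        (Computable.succ.comp (Computable.snd.comp Computable.fst)))
      (Primrec.nat_mul.to_comp.comp (Computable.const 2) (Primrec.nat_mul.to_comp.comp
        (Computable.fst.comp Computable.fst) (Computable.rat_den.comp hq)))
  have hP : ComputablePred fun x : (ℕ × ℕ) × ℕ =>
      r x.2 = (x.1.1 : ℚ) / (x.1.2 + 1 : ℕ) := by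
    refine ⟨inferInstance, (Primrec.and.to_comp.comp heven heq).of_eq fun x => ?_⟩
    rw [← Bool.decide_and]
    exact decide_eq_decide.2 (Rat.eq_div_succ_iff _ _ _).symm
  refine (hr.comp (Computable.find (P := fun (p : ℕ × ℕ) i =>
    r i = (p.1 : ℚ) / (p.2 + 1 : ℕ)) hP hex)).of_eq fun p => ?_
  exact Nat.find_spec (hex p)

theorem Computable.natCast_div_succ :
    Computable fun p : ℕ × ℕ => (p.1 : ℚ) / (p.2 + 1 : ℕ) :=
  natCast_div_succ_of_enumeration (Computable.ofNat ℚ) fun q => ⟨_, Denumerable.ofNat_encode q⟩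

end RationalCodes

section Domination

theorem zeros_injective : Function.Injective zeros := fun a b h => by
  simpa [zeros] using congrArg List.length h

theorem length_zeros (t : ℕ) : (zeros t).length = t := List.length_replicate

theorem computable_zeros : Computable zeros := by
  have h := Primrec.nat_rec₁ (f := fun _ l => false :: l) ([] : List Bool)
    (Primrec.list_cons.comp (Primrec.const false) Primrec.snd).to₂
  refine h.to_comp.of_eq fun n => ?_
  induction n with
  | zero => rfl
  | succ n ih => exact congrArg (false :: ·) ih

theorem qval_natCast_div (a b : ℕ) :
    qval ((a : ℚ) / (b + 1 : ℕ)) = (a : ℝ≥0∞) / (b + 1 : ℕ) := by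
  have hb : (0 : ℝ) < (b + 1 : ℕ) := by positivity
  rw [qval, Rat.cast_div, Rat.cast_natCast, Rat.cast_natCast, ENNReal.ofReal_div_of_pos hb,
    ENNReal.ofReal_natCast, ENNReal.ofReal_natCast]

theorem div_succ_le_mul_iff (a b c : ℕ) {q : ℚ} (hq : 0 ≤ q) :
    (a : ℚ) / (b + 1 : ℕ) ≤ c * q ↔ a * q.den ≤ c * q.num.natAbs * (b + 1) := by
  have hb : (0 : ℚ) < (b + 1 : ℕ) := by positivity
  have hd : (0 : ℚ) < q.den := by exact_mod_cast q.den_pos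
  have hn : ((q.num.natAbs : ℕ) : ℚ) = q * q.den := by
    rw [Rat.mul_den_eq_num, Nat.cast_natAbs, abs_of_nonneg (Rat.num_nonneg.2 hq)]
  rw [div_le_iff₀ hb, ← mul_le_mul_iff_left₀ hd, ← Nat.cast_le (α := ℚ)]
  push_cast [hn]
  ring_nf

/-- The rational-valued function on bitstrings taking the value `w t / (b t + 1)` at the string of
`t` zeros and vanishing elsewhere. -/
def zerosRatio (w b : ℕ → ℕ) (x : List Bool) : ℚ :=
  bif decide (x = zeros x.length) then (w x.length : ℚ) / (b x.length + 1 : ℕ) else 0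

theorem computable_decide_eq_zeros :
    Computable fun x : List Bool => decide (x = zeros x.length) := by
  have h : Computable₂ fun x y : List Bool => decide (x = y) := Primrec.eq.decide.to_comp
  exact h.comp Computable.id (computable_zeros.comp Computable.list_length)

theorem computable_zerosRatio {w b : ℕ → ℕ} (hw : Computable w) (hb : Computable b) :
    Computable (zerosRatio w b) := by
  have hpair : Computable fun x : List Bool => (w x.length, b x.length) :=
    (hw.comp Computable.list_length).pair (hb.comp Computable.list_length)
  have hratio := Computable.natCast_div_succ.comp hpair
  exact Computable.cond computable_decide_eq_zeros hratio (Computable.const 0)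

theorem zerosRatio_nonneg (w b : ℕ → ℕ) (x : List Bool) : 0 ≤ zerosRatio w b x := by
  unfold zerosRatio
  cases decide (x = zeros x.length)
  · exact le_rfl
  · exact div_nonneg (Nat.cast_nonneg _) (Nat.cast_nonneg _)

theorem qval_zerosRatio_zeros (w b : ℕ → ℕ) (t : ℕ) :
    qval (zerosRatio w b (zeros t)) = (w t : ℝ≥0∞) / (b t + 1 : ℕ) := by
  simp only [zerosRatio, length_zeros, decide_true, cond_true, qval_natCast_div]

theorem tsum_qval_zerosRatio (w b : ℕ → ℕ) :
    ∑' x, qval (zerosRatio w b x) = ∑' t, (w t : ℝ≥0∞) / (b t + 1 : ℕ) := by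
  rw [← zeros_injective.tsum_eq]
  · simp only [qval_zerosRatio_zeros]
  · intro x hx
    by_contra h
    have hne : x ≠ zeros x.length := fun h' => h ⟨_, h'.symm⟩
    simp [zerosRatio, hne, qval] at hx

theorem lowerSemicomputable_qval {p : List Bool → ℚ} (hp : Computable p) (h0 : ∀ x, 0 ≤ p x) :
    LowerSemicomputable fun x => qval (p x) :=
  ⟨fun x _ => p x, hp.comp Computable.fst, fun x _ => h0 x, fun _ => monotone_const,
    fun _ => ciSup_const.symm⟩

/-- The first stage at which a computable family of nonnegative rationals satisfies a computable
lower bound is computable. -/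
theorem exists_computable_first_stage {q : ℕ → ℕ → ℚ} (hq : Computable₂ q)
    (hq0 : ∀ t s, 0 ≤ q t s) {w b : ℕ → ℕ} (hw : Computable w) (hb : Computable b) (c : ℕ)
    (hex : ∀ t, ∃ s, (w t : ℚ) / (b t + 1 : ℕ) ≤ c * q t s) :
    ∃ f : ℕ → ℕ, Computable f ∧ ∀ t, (w t : ℚ) / (b t + 1 : ℕ) ≤ c * q t (f t) := by
  have hle : Computable₂ fun a b : ℕ => decide (a ≤ b) := Primrec.nat_le.decide.to_comp
  have hnum : Computable₂ fun t s => c * (q t s).num.natAbs * (b t + 1) :=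
    Primrec.nat_mul.to_comp.comp
      (Primrec.nat_mul.to_comp.comp (Computable.const c)
        (Computable.int_natAbs.comp (Computable.rat_num.comp hq)))
      (Computable.succ.comp (hb.comp Computable.fst))
  have hden : Computable₂ fun t s => w t * (q t s).den :=
    Primrec.nat_mul.to_comp.comp (hw.comp Computable.fst) (Computable.rat_den.comp hq)
  have hP : ComputablePred fun p : ℕ × ℕ => (w p.1 : ℚ) / (b p.1 + 1 : ℕ) ≤ c * q p.1 p.2 := by
    refine ⟨inferInstance, (hle.comp hden hnum).of_eq fun p => ?_⟩
    exact decide_eq_decide.2 (div_succ_le_mul_iff _ _ _ (hq0 _ _)).symm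
  exact ⟨_, Computable.find (P := fun t s => (w t : ℚ) / (b t + 1 : ℕ) ≤ c * q t s) hP hex,
    fun t => Nat.find_spec (hex t)⟩

theorem qval_le_natCast_mul_qval_iff {p q : ℚ} (hq : 0 ≤ q) (c : ℕ) :
    qval p ≤ c * qval q ↔ p ≤ c * q := by
  rw [qval, qval, ← ENNReal.ofReal_natCast, ← ENNReal.ofReal_mul (Nat.cast_nonneg _),
    ENNReal.ofReal_le_ofReal_iff (mul_nonneg (Nat.cast_nonneg _) (Rat.cast_nonneg.2 hq))]
  exact_mod_cast Iff.rfl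

theorem exists_computable_stage {m : List Bool → ℝ≥0∞} {mt : List Bool → ℕ → ℚ}
    (hm : IsUniversalSemimeasure m) (hmt : IsApproxFromBelow m mt) {w b : ℕ → ℕ}
    (hw : Computable w) (hb : Computable b)
    (hsum : ∑' t, (w t : ℝ≥0∞) / (b t + 1 : ℕ) ≤ 1) :
    ∃ f : ℕ → ℕ, Computable f ∧ ∃ c : ℕ, 0 < c ∧
      ∀ t, (w t : ℝ≥0∞) / (b t + 1 : ℕ) ≤ c * qval (mt (zeros t) (f t)) := by
  obtain ⟨c, hc0, hc⟩ := hm.2.2 _ ((tsum_qval_zerosRatio w b).trans_le hsum)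
    (lowerSemicomputable_qval (computable_zerosRatio hw hb) (zerosRatio_nonneg w b))
  obtain ⟨c', hc'⟩ := exists_nat_gt c
  have hex (t : ℕ) : ∃ s, (w t : ℚ) / (b t + 1 : ℕ) ≤ c' * mt (zeros t) s := by
    suffices h : ∃ s, (w t : ℝ≥0∞) / (b t + 1 : ℕ) ≤ c' * qval (mt (zeros t) s) by
      obtain ⟨s, hs⟩ := h
      exact ⟨s, (qval_le_natCast_mul_qval_iff (hmt.2.1 _ _) _).1 (by rwa [qval_natCast_div])⟩
    have hle := hc (zeros t)
    rw [qval_zerosRatio_zeros] at hle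
    rcases eq_or_ne ((w t : ℝ≥0∞) / (b t + 1 : ℕ)) 0 with h0 | h0
    · exact ⟨0, by rw [h0]; exact zero_le⟩
    · have hm0 : m (zeros t) ≠ 0 := fun h => h0 (by simpa [h] using hle)
      have hm1 : m (zeros t) ≠ ⊤ :=
        (((ENNReal.le_tsum _).trans hm.1).trans_lt ENNReal.one_lt_top).ne
      have hlt : (w t : ℝ≥0∞) / (b t + 1 : ℕ) < c' * m (zeros t) :=
        hle.trans_lt ((ENNReal.mul_lt_mul_iff_left hm0 hm1).2 (by exact_mod_cast hc'))
      rw [hmt.2.2.2, ENNReal.mul_iSup, lt_iSup_iff] at hlt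
      obtain ⟨s, hs⟩ := hlt
      exact ⟨s, hs.le⟩
  have hpair : Computable fun p : ℕ × ℕ => (zeros p.1, p.2) :=
    (computable_zeros.comp Computable.fst).pair Computable.snd
  have hval := hmt.1.comp hpair
  obtain ⟨f, hf, hfs⟩ := exists_computable_first_stage (q := fun t s => mt (zeros t) s) hval
    (fun t s => hmt.2.1 _ s) hw hb c' hex
  refine ⟨f, hf, c', ?_, fun t => ?_⟩
  · exact_mod_cast (zero_le (a := c)).trans_lt hc'
  · rw [← qval_natCast_div]
    exact (qval_le_natCast_mul_qval_iff (hmt.2.1 _ _) _).2 (hfs t)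

end Domination

section TruncatedMass

open Encodable Finset

variable {m : List Bool → ℝ≥0∞} {mt : List Bool → ℕ → ℚ}

/-- The stage-`t` approximation in units of `2⁻ᵗ`, rounded down. -/
def scaledApprox (mt : List Bool → ℕ → ℚ) (t : ℕ) (x : List Bool) : ℕ :=
  2 ^ t * (mt x t).num.natAbs / (mt x t).den

/-- The rounded stage-`t` approximation restricted to the strings with code below `t`. -/
def truncApprox (mt : List Bool → ℕ → ℚ) (t : ℕ) (x : List Bool) : ℕ :=
  if encode x < t then scaledApprox mt t x else 0

/-- The total of the truncated stage-`t` approximation. -/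
def stageMass (mt : List Bool → ℕ → ℚ) (t : ℕ) : ℕ :=
  ∑ i ∈ range t, (decode₂ (List Bool) i).elim 0 (scaledApprox mt t)

theorem tsum_truncApprox (mt : List Bool → ℕ → ℚ) (t : ℕ) :
    ∑' x, (truncApprox mt t x : ℝ≥0∞) = stageMass mt t := by
  let F : ℕ → ℝ≥0∞ := fun i => (decode₂ (List Bool) i).elim 0 fun x => (truncApprox mt t x : ℝ≥0∞)
  have hF (x : List Bool) : F (encode x) = truncApprox mt t x := by
    simp [F]
  have hsupp : Function.support F ⊆ Set.range (encode : List Bool → ℕ) := by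
    intro i hi
    rcases h : decode₂ (List Bool) i with _ | x
    · simp [F, h] at hi
    · exact ⟨x, mem_decode₂.1 h⟩
  have h1 := (encode_injective (α := List Bool)).tsum_eq hsupp
  simp only [hF] at h1
  rw [h1, tsum_eq_sum (s := range t), stageMass, Nat.cast_sum]
  · refine sum_congr rfl fun i hi => ?_
    rcases h : decode₂ (List Bool) i with _ | x
    · simp [F, h]
    · have hx : encode x < t := by rw [mem_decode₂.1 h]; exact mem_range.1 hi
      simp [F, h, truncApprox, hx]
  · intro i hi
    rcases h : decode₂ (List Bool) i with _ | x
    · simp [F, h]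
    · have hx : ¬ encode x < t := by rw [mem_decode₂.1 h]; simpa using hi
      simp [F, h, truncApprox, hx]

theorem scaledApprox_eq_floor (hmt : IsApproxFromBelow m mt) (t : ℕ) (x : List Bool) :
    scaledApprox mt t x = ⌊2 ^ t * mt x t⌋₊ := by
  have hn : ((mt x t).num.natAbs : ℚ) = (mt x t).num := by
    rw [Nat.cast_natAbs, abs_of_nonneg (Rat.num_nonneg.2 (hmt.2.1 x t))]
  rw [scaledApprox, ← Nat.floor_div_eq_div (K := ℚ)]
  push_cast
  rw [hn, mul_div_assoc, Rat.num_div_den]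

theorem truncApprox_div_le (hmt : IsApproxFromBelow m mt) (t : ℕ) (x : List Bool) :
    (truncApprox mt t x : ℝ≥0∞) / 2 ^ t ≤ qval (mt x t) := by
  rw [truncApprox]
  split_ifs
  · have h : (scaledApprox mt t x : ℚ) ≤ 2 ^ t * mt x t := by
      rw [scaledApprox_eq_floor hmt]
      exact Nat.floor_le (mul_nonneg (by positivity) (hmt.2.1 x t))
    refine ENNReal.div_le_of_le_mul ?_
    have h' : (scaledApprox mt t x : ℝ) ≤ mt x t * 2 ^ t := by
      rw [mul_comm]
      exact_mod_cast h
    rw [qval, ← ENNReal.ofReal_natCast, show (2 : ℝ≥0∞) ^ t = ENNReal.ofReal (2 ^ t) by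
      rw [ENNReal.ofReal_pow two_pos.le, ENNReal.ofReal_ofNat],
      ← ENNReal.ofReal_mul (Rat.cast_nonneg.2 (hmt.2.1 x t))]
    exact ENNReal.ofReal_le_ofReal h'
  · simp

theorem qval_le_truncApprox_div_add (hmt : IsApproxFromBelow m mt) {t : ℕ} {x : List Bool}
    (hx : encode x < t) :
    qval (mt x t) ≤ (truncApprox mt t x : ℝ≥0∞) / 2 ^ t + (2⁻¹) ^ t := by
  rw [truncApprox, if_pos hx, ← ENNReal.inv_pow, ← one_div, ← ENNReal.add_div,
    ENNReal.le_div_iff_mul_le (by simp) (by simp)]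
  have h : 2 ^ t * mt x t ≤ (scaledApprox mt t x + 1 : ℕ) := by
    rw [scaledApprox_eq_floor hmt]
    exact_mod_cast (Nat.lt_floor_add_one (2 ^ t * mt x t)).le
  have h' : mt x t * 2 ^ t ≤ ((scaledApprox mt t x + 1 : ℕ) : ℝ) := by
    rw [mul_comm]
    exact_mod_cast h
  rw [qval, show (2 : ℝ≥0∞) ^ t = ENNReal.ofReal (2 ^ t) by
      rw [ENNReal.ofReal_pow two_pos.le, ENNReal.ofReal_ofNat],
      ← ENNReal.ofReal_mul (Rat.cast_nonneg.2 (hmt.2.1 x t))]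
  refine (ENNReal.ofReal_le_ofReal h').trans_eq ?_
  rw [ENNReal.ofReal_natCast]
  push_cast
  rfl

theorem qval_mono : Monotone qval := fun _ _ h =>
  ENNReal.ofReal_le_ofReal (by exact_mod_cast h)

theorem IsApproxFromBelow.qval_le (hmt : IsApproxFromBelow m mt) (t : ℕ) (x : List Bool) :
    qval (mt x t) ≤ m x := by
  rw [hmt.2.2.2 x]
  exact le_iSup (fun s => qval (mt x s)) t

theorem two_mul_truncApprox_le (hmt : IsApproxFromBelow m mt) (t : ℕ) (x : List Bool) :
    2 * truncApprox mt t x ≤ truncApprox mt (t + 1) x := by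
  rw [truncApprox, truncApprox]
  split_ifs with h1 h2
  · rw [scaledApprox_eq_floor hmt, scaledApprox_eq_floor hmt]
    refine Nat.le_floor ?_
    have hmono : mt x t ≤ mt x (t + 1) := hmt.2.2.1 x (Nat.le_succ t)
    have hfl : (⌊2 ^ t * mt x t⌋₊ : ℚ) ≤ 2 ^ t * mt x t :=
      Nat.floor_le (mul_nonneg (by positivity) (hmt.2.1 x t))
    push_cast
    calc (2 : ℚ) * ⌊2 ^ t * mt x t⌋₊
      ≤ 2 * (2 ^ t * mt x (t + 1)) := by gcongr; exact hfl.trans (by gcongr)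
      _ = 2 ^ (t + 1) * mt x (t + 1) := by ring
  · omega
  · simp
  · simp

theorem monotone_truncApprox_div (hmt : IsApproxFromBelow m mt) (x : List Bool) :
    Monotone fun t => (truncApprox mt t x : ℝ≥0∞) / 2 ^ t := by
  refine monotone_nat_of_le_succ fun t => ?_
  rw [← ENNReal.mul_div_mul_left _ _ two_ne_zero ENNReal.ofNat_ne_top, ← pow_succ']
  gcongr
  exact_mod_cast two_mul_truncApprox_le hmt t x

theorem tendsto_truncApprox_div (hmt : IsApproxFromBelow m mt) (x : List Bool) :
    Filter.Tendsto (fun t => (truncApprox mt t x : ℝ≥0∞) / 2 ^ t) Filter.atTop (nhds (m x)) := by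
  have hq : Filter.Tendsto (fun t => qval (mt x t)) Filter.atTop (nhds (m x)) := by
    rw [hmt.2.2.2 x]
    exact tendsto_atTop_iSup (qval_mono.comp (hmt.2.2.1 x))
  have hpow : Filter.Tendsto (fun t : ℕ => (2⁻¹ : ℝ≥0∞) ^ t) Filter.atTop (nhds 0) :=
    ENNReal.tendsto_pow_atTop_nhds_zero_of_lt_one (by simp)
  have hlow : Filter.Tendsto (fun t => qval (mt x t) - (2⁻¹ : ℝ≥0∞) ^ t) Filter.atTop
      (nhds (m x)) := by
    simpa using ENNReal.Tendsto.sub hq hpow (Or.inr ENNReal.zero_ne_top)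
  refine tendsto_of_tendsto_of_tendsto_of_le_of_le' hlow hq ?_
    (Filter.Eventually.of_forall fun t => truncApprox_div_le hmt t x)
  filter_upwards [Filter.eventually_gt_atTop (encode x)] with t ht
  exact tsub_le_iff_right.2 (qval_le_truncApprox_div_add hmt ht)

theorem tsum_truncApprox_div (mt : List Bool → ℕ → ℚ) (t : ℕ) :
    ∑' x, (truncApprox mt t x : ℝ≥0∞) / 2 ^ t = (stageMass mt t : ℝ≥0∞) / 2 ^ t := by
  simp only [div_eq_mul_inv]
  rw [ENNReal.tsum_mul_right, tsum_truncApprox]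

theorem two_mul_stageMass_le (hmt : IsApproxFromBelow m mt) (t : ℕ) :
    2 * stageMass mt t ≤ stageMass mt (t + 1) := by
  have h : (2 * stageMass mt t : ℝ≥0∞) ≤ stageMass mt (t + 1) := by
    rw [← tsum_truncApprox, ← tsum_truncApprox, ← ENNReal.tsum_mul_left]
    exact ENNReal.tsum_le_tsum fun x => by exact_mod_cast two_mul_truncApprox_le hmt t x
  exact_mod_cast h

theorem stageMass_le (hmt : IsApproxFromBelow m mt) (hm : IsSemimeasure m) (t : ℕ) :
    stageMass mt t ≤ 2 ^ t := by
  have h : (stageMass mt t : ℝ≥0∞) / 2 ^ t ≤ 1 := by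
    rw [← tsum_truncApprox_div]
    exact (ENNReal.tsum_le_tsum fun x =>
      (truncApprox_div_le hmt t x).trans (hmt.qval_le t x)).trans hm
  rw [ENNReal.div_le_iff (by simp) (by simp), one_mul] at h
  exact_mod_cast h

/-- If the truncated total never exceeds `ε`, neither does the semimeasure of any set. -/
theorem tsum_subtype_le_of_stageMass_le (hmt : IsApproxFromBelow m mt) {ε : ℝ≥0∞}
    (h : ∀ᶠ s in Filter.atTop, (stageMass mt s : ℝ≥0∞) / 2 ^ s ≤ ε)
    (p : List Bool → Prop) :
    ∑' x : {x // p x}, m x.1 ≤ ε := by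
  rw [ENNReal.tsum_eq_iSup_sum]
  refine iSup_le fun F => ?_
  refine le_of_tendsto (tendsto_finsetSum F fun x _ => tendsto_truncApprox_div hmt x.1) ?_
  filter_upwards [h] with s hs
  refine le_trans ?_ hs
  rw [← tsum_truncApprox_div]
  exact (ENNReal.sum_le_tsum F).trans
    (ENNReal.tsum_comp_le_tsum_of_injective Subtype.val_injective _)

/-- If after stage `t` the truncated total grows by at most `ε`, then the strings whose semimeasure
at least doubles after stage `t` carry at most `2 ε`. -/
theorem tsum_subtype_le_two_mul (hmt : IsApproxFromBelow m mt) (hm : IsSemimeasure m)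
    {ε : ℝ≥0∞} {t : ℕ}
    (h : ∀ s, t ≤ s → (stageMass mt s : ℝ≥0∞) / 2 ^ s ≤ (stageMass mt t : ℝ≥0∞) / 2 ^ t + ε)
    (p : List Bool → Prop) (hp : ∀ x, p x → 2 * qval (mt x t) ≤ m x) :
    ∑' x : {x // p x}, m x.1 ≤ 2 * ε := by
  let ν : ℕ → List Bool → ℝ≥0∞ := fun s x => (truncApprox mt s x : ℝ≥0∞) / 2 ^ s
  have hνm (s x) : ν s x ≤ m x := (truncApprox_div_le hmt s x).trans (hmt.qval_le s x)
  have hfin (s : ℕ) (q : List Bool → Prop) : ∑' x : {x // q x}, ν s x.1 ≠ ⊤ :=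
    (((ENNReal.tsum_comp_le_tsum_of_injective Subtype.val_injective _).trans
      ((ENNReal.tsum_le_tsum (hνm s)).trans hm)).trans_lt ENNReal.one_lt_top).ne
  have hsplit (s : ℕ) : ∑' x : {x // p x}, ν s x.1 + ∑' x : {x // ¬ p x}, ν s x.1 =
      (stageMass mt s : ℝ≥0∞) / 2 ^ s := by
    rw [← tsum_truncApprox_div]
    exact ENNReal.summable.tsum_add_tsum_compl (s := {x | p x}) ENNReal.summable
  have hgrow (s : ℕ) (hs : t ≤ s) :
      ∑' x : {x // p x}, ν s x.1 ≤ ∑' x : {x // p x}, ν t x.1 + ε := by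
    have h1 := h s hs
    rw [← hsplit, ← hsplit, add_right_comm] at h1
    refine (ENNReal.add_le_add_iff_right (hfin t fun x => ¬ p x)).1 (le_trans ?_ h1)
    gcongr with x
    exact monotone_truncApprox_div hmt x.1 hs
  have hhalf : 2 * ∑' x : {x // p x}, ν t x.1 ≤ ∑' x : {x // p x}, m x.1 := by
    rw [← ENNReal.tsum_mul_left]
    refine ENNReal.tsum_le_tsum fun x => le_trans ?_ (hp x.1 x.2)
    gcongr
    exact truncApprox_div_le hmt t x.1
  have hlim : ∑' x : {x // p x}, m x.1 ≤ ∑' x : {x // p x}, ν t x.1 + ε := by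
    rw [ENNReal.tsum_eq_iSup_sum]
    refine iSup_le fun F => ?_
    refine le_of_tendsto (tendsto_finsetSum F fun x _ => tendsto_truncApprox_div hmt x.1) ?_
    filter_upwards [Filter.eventually_ge_atTop t] with s hs
    exact (ENNReal.sum_le_tsum F).trans (hgrow s hs)
  have hS : ∑' x : {x // p x}, m x.1 ≠ ⊤ :=
    (((ENNReal.tsum_comp_le_tsum_of_injective Subtype.val_injective _).trans
      hm).trans_lt ENNReal.one_lt_top).ne
  refine (ENNReal.add_le_add_iff_left hS).1 ?_
  calc ∑' x : {x // p x}, m x.1 + ∑' x : {x // p x}, m x.1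
      ≤ (∑' x : {x // p x}, ν t x.1 + ε) + (∑' x : {x // p x}, ν t x.1 + ε) := by gcongr
    _ = 2 * ∑' x : {x // p x}, ν t x.1 + 2 * ε := by ring
    _ ≤ ∑' x : {x // p x}, m x.1 + 2 * ε := by gcongr

theorem Computable.sum_range {α : Type*} [Primcodable α] {n : α → ℕ} {f : α → ℕ → ℕ}
    (hn : Computable n) (hf : Computable₂ f) :
    Computable fun a => ∑ i ∈ range (n a), f a i := by
  have hstep : Computable₂ fun (a : α) (p : ℕ × ℕ) => p.2 + f a p.1 :=
    Primrec.nat_add.to_comp.comp (Computable.snd.comp Computable.snd)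
      (hf.comp Computable.fst (Computable.fst.comp Computable.snd))
  refine (Computable.nat_rec hn (Computable.const 0) hstep).of_eq fun a => ?_
  induction n a with
  | zero => rfl
  | succ k ih => rw [sum_range_succ, ← ih]

theorem Computable.nat_two_pow : Computable fun n : ℕ => 2 ^ n := by
  have hstep : Computable₂ fun (_ : ℕ) (p : ℕ × ℕ) => p.2 * 2 :=
    Primrec.nat_mul.to_comp.comp (Computable.snd.comp Computable.snd) (Computable.const 2)
  refine (Computable.nat_rec Computable.id (Computable.const 1) hstep).of_eq fun n => ?_
  induction n with
  | zero => rfl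
  | succ k ih => rw [pow_succ, ← ih]; rfl

theorem computable_stageMass (hmt : IsApproxFromBelow m mt) : Computable (stageMass mt) := by
  have hpair : Computable fun y : (ℕ × ℕ) × List Bool => (y.2, y.1.1) :=
    Computable.snd.pair (Computable.fst.comp Computable.fst)
  have hval := hmt.1.comp hpair
  have hscaled : Computable₂ fun (p : ℕ × ℕ) (x : List Bool) => scaledApprox mt p.1 x :=
    Primrec.nat_div.to_comp.comp
      (Primrec.nat_mul.to_comp.comp
        (Computable.nat_two_pow.comp (Computable.fst.comp Computable.fst))
        (Computable.int_natAbs.comp (Computable.rat_num.comp hval)))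
      (Computable.rat_den.comp hval)
  have hdec : Computable fun p : ℕ × ℕ => decode₂ (List Bool) p.2 :=
    Primrec.decode₂.to_comp.comp Computable.snd
  have hterm : Computable₂ fun t i : ℕ =>
      (decode₂ (List Bool) i).elim 0 (scaledApprox mt t) :=
    (Computable.option_casesOn hdec (Computable.const 0) hscaled).of_eq fun p => by
      dsimp only
      cases decode₂ (List Bool) p.2 <;> rfl
  exact Computable.sum_range Computable.id hterm

end TruncatedMass

section Levels

open Finset

variable {A : ℕ → ℕ}

/-- The number of full multiples of `j ^ 3 / 2 ^ j` in `A t / 2 ^ t`, counted from stage `j` on. -/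
def level (A : ℕ → ℕ) (j t : ℕ) : ℕ :=
  if j ≤ t then A t * 2 ^ j / (2 ^ t * j ^ 3) else 0

theorem level_le (hA : ∀ t, A t ≤ 2 ^ t) (j t : ℕ) : level A j t ≤ 2 ^ j / j ^ 3 := by
  rw [level]
  split_ifs
  · rw [← Nat.mul_div_mul_left (2 ^ j) (j ^ 3) (Nat.two_pow_pos t)]
    exact Nat.div_le_div_right (Nat.mul_le_mul_right _ (hA t))
  · exact Nat.zero_le _

theorem level_zero_right (A : ℕ → ℕ) (j : ℕ) : level A j 0 = 0 := by
  rcases j with _ | j <;> simp [level]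

theorem monotone_level (hA : ∀ t, 2 * A t ≤ A (t + 1)) (j : ℕ) : Monotone (level A j) := by
  refine monotone_nat_of_le_succ fun t => ?_
  rw [level, level]
  split_ifs with h1 h2
  · rw [← Nat.mul_div_mul_left _ _ two_pos, ← mul_assoc, ← mul_assoc, ← pow_succ']
    exact Nat.div_le_div_right (Nat.mul_le_mul_right _ (hA t))
  · omega
  · exact Nat.zero_le _
  · exact le_rfl

theorem level_eq_zero_or_exists_last_jump (hA : ∀ t, A t ≤ 2 ^ t)
    (hA' : ∀ t, 2 * A t ≤ A (t + 1)) (j : ℕ) :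
    (∀ t, level A j t = 0) ∨
      ∃ t, j ≤ t ∧ level A j (t - 1) < level A j t ∧ ∀ s, t ≤ s → level A j s = level A j t := by
  refine or_iff_not_imp_left.2 fun h => ?_
  push Not at h
  obtain ⟨t₀, ht₀⟩ := h
  have hbdd : BddAbove (Set.range (level A j)) := ⟨_, Set.forall_mem_range.2 (level_le hA j)⟩
  have hmem := Nat.sSup_mem (Set.range_nonempty (level A j)) hbdd
  have hle (s : ℕ) : level A j s ≤ sSup (Set.range (level A j)) := le_csSup hbdd ⟨s, rfl⟩
  have hspec := Nat.find_spec hmem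
  have hmin := fun {k : ℕ} => Nat.find_min (m := k) hmem
  set t := Nat.find hmem
  have hpos : 0 < level A j t := by
    rw [hspec]
    exact (Nat.pos_of_ne_zero ht₀).trans_le (hle t₀)
  have ht : t ≠ 0 := fun h => by rw [h, level_zero_right] at hpos; exact hpos.false
  refine ⟨t, ?_, ?_, fun s hs => ?_⟩
  · by_contra hjt
    rw [level, if_neg hjt] at hpos
    exact hpos.false
  · rw [hspec]
    exact lt_of_le_of_ne (hle _) (hmin (by omega))
  · exact le_antisymm (hspec ▸ hle s) (monotone_level hA' j hs)

theorem natCast_div_two_pow (a t : ℕ) : (a : ℝ≥0∞) / 2 ^ t = ENNReal.ofReal (a / 2 ^ t) := by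
  rw [ENNReal.ofReal_div_of_pos (by positivity), ENNReal.ofReal_natCast,
    ENNReal.ofReal_pow two_pos.le, ENNReal.ofReal_ofNat]

theorem div_two_pow_lt_of_level {j s : ℕ} (hj : 0 < j) (hs : j ≤ s) :
    (A s : ℝ) / 2 ^ s < (level A j s + 1) * (j ^ 3 / 2 ^ j) := by
  have h : A s * 2 ^ j < (level A j s + 1) * (2 ^ s * j ^ 3) := by
    rw [level, if_pos hs]
    exact Nat.lt_mul_of_div_lt (Nat.lt_succ_self _) (by positivity)
  rw [← mul_div_assoc, div_lt_div_iff₀ (by positivity) (by positivity)]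
  have h' : (A s * 2 ^ j : ℝ) < (level A j s + 1) * (2 ^ s * j ^ 3) := by exact_mod_cast h
  linarith

theorem level_mul_le (j s : ℕ) : level A j s * (j ^ 3 / 2 ^ j) ≤ (A s : ℝ) / 2 ^ s := by
  have h : level A j s * (2 ^ s * j ^ 3) ≤ A s * 2 ^ j := by
    rw [level]
    split_ifs
    · exact Nat.div_mul_le_self _ _
    · simp
  rw [← mul_div_assoc, div_le_div_iff₀ (by positivity) (by positivity)]
  have h' : level A j s * (2 ^ s * j ^ 3) ≤ (A s * 2 ^ j : ℝ) := by exact_mod_cast h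
  linarith

theorem div_two_pow_le_of_level_eq_zero {j s : ℕ} (hj : 0 < j) (hs : j ≤ s)
    (h : level A j s = 0) : (A s : ℝ≥0∞) / 2 ^ s ≤ ENNReal.ofReal (j ^ 3 / 2 ^ j) := by
  rw [natCast_div_two_pow]
  refine ENNReal.ofReal_le_ofReal ?_
  simpa [h] using (div_two_pow_lt_of_level (A := A) hj hs).le

theorem div_two_pow_le_add_of_level_eq {j s t : ℕ} (hj : 0 < j) (hs : j ≤ s)
    (h : level A j s = level A j t) :
    (A s : ℝ≥0∞) / 2 ^ s ≤ (A t : ℝ≥0∞) / 2 ^ t + ENNReal.ofReal (j ^ 3 / 2 ^ j) := by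
  rw [natCast_div_two_pow, natCast_div_two_pow,
    ← ENNReal.ofReal_add (by positivity) (by positivity)]
  refine ENNReal.ofReal_le_ofReal ?_
  have h1 := div_two_pow_lt_of_level (A := A) hj hs
  have h2 := level_mul_le (A := A) j t
  rw [h] at h1
  linarith

/-- The weight of stage `t`, in units of `2⁻ᵗ`: every scale `j ≤ t` contributes
`j * √j / 2 ^ j` for each level passed at stage `t`. -/
def jumpWeight (A : ℕ → ℕ) (t : ℕ) : ℕ :=
  ∑ j ∈ range (t + 1), j * j.sqrt * 2 ^ (t - j) * (level A j t - level A j (t - 1))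

theorem jumpWeight_div (A : ℕ → ℕ) (t : ℕ) :
    (jumpWeight A t : ℝ≥0∞) / 2 ^ t = ∑ j ∈ range (t + 1),
      ((j * j.sqrt : ℕ) : ℝ≥0∞) / 2 ^ j * ((level A j t - level A j (t - 1) : ℕ) : ℝ≥0∞) := by
  rw [jumpWeight, Nat.cast_sum, div_eq_mul_inv, sum_mul]
  refine sum_congr rfl fun j hj => ?_
  have hjt : j ≤ t := Nat.lt_succ_iff.1 (mem_range.1 hj)
  have hpow : (2 : ℝ≥0∞) ^ (t - j) * (2 ^ t)⁻¹ = (2 ^ j)⁻¹ := by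
    have hsplit : (2 : ℝ≥0∞) ^ t = 2 ^ (t - j) * 2 ^ j := by
      rw [← pow_add, Nat.sub_add_cancel hjt]
    rw [hsplit, ENNReal.mul_inv (Or.inl (by simp)) (Or.inl (by simp)), ← mul_assoc,
      ENNReal.mul_inv_cancel (by simp) (by simp), one_mul]
  rw [Nat.cast_mul, Nat.cast_mul _ (2 ^ (t - j)), Nat.cast_pow, Nat.cast_ofNat,
    div_eq_mul_inv, ← hpow]
  ring

theorem le_jumpWeight_div {j t : ℕ} (hjt : j ≤ t) (h : level A j (t - 1) < level A j t) :
    ((j * j.sqrt : ℕ) : ℝ≥0∞) / 2 ^ j ≤ (jumpWeight A t : ℝ≥0∞) / 2 ^ t := by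
  rw [jumpWeight_div]
  refine le_trans ?_ (single_le_sum (fun _ _ => zero_le)
    (mem_range.2 (Nat.lt_succ_iff.2 hjt)))
  refine le_mul_of_one_le_right zero_le ?_
  exact_mod_cast Nat.sub_pos_of_lt h

theorem tsum_level_sub_le (hA : ∀ t, A t ≤ 2 ^ t) (hA' : ∀ t, 2 * A t ≤ A (t + 1)) (j : ℕ) :
    ∑' t, ((level A j t - level A j (t - 1) : ℕ) : ℝ≥0∞) ≤ (2 ^ j / j ^ 3 : ℕ) := by
  refine ENNReal.tsum_le_of_sum_range_le fun T => ?_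
  rw [← Nat.cast_sum, Nat.cast_le]
  have h (T : ℕ) : ∑ t ∈ range T, (level A j t - level A j (t - 1)) ≤ level A j (T - 1) := by
    induction T with
    | zero => simp
    | succ T ih =>
      have := monotone_level hA' j (Nat.sub_le T 1)
      rw [sum_range_succ, Nat.add_sub_cancel]
      omega
  exact (h T).trans (level_le hA j _)

theorem exists_tsum_scale_weights_le :
    ∃ D : ℕ, 0 < D ∧
      ∑' j : ℕ, ((j * j.sqrt : ℕ) : ℝ≥0∞) / 2 ^ j * (2 ^ j / j ^ 3 : ℕ) ≤ D := by
  have hsum : Summable fun j : ℕ => 1 / (j : ℝ) ^ (3 / 2 : ℝ) :=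
    Real.summable_one_div_nat_rpow.2 (by norm_num)
  obtain ⟨D, hD⟩ := exists_nat_ge (∑' j : ℕ, 1 / (j : ℝ) ^ (3 / 2 : ℝ))
  refine ⟨D + 1, Nat.succ_pos D, ?_⟩
  calc ∑' j : ℕ, ((j * j.sqrt : ℕ) : ℝ≥0∞) / 2 ^ j * (2 ^ j / j ^ 3 : ℕ)
      ≤ ∑' j : ℕ, ENNReal.ofReal (1 / (j : ℝ) ^ (3 / 2 : ℝ)) := by
        refine ENNReal.tsum_le_tsum fun j => ?_
        rw [natCast_div_two_pow, ← ENNReal.ofReal_natCast, ← ENNReal.ofReal_mul (by positivity)]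
        refine ENNReal.ofReal_le_ofReal ?_
        rcases Nat.eq_zero_or_pos j with rfl | hj
        · simp
        have hj' : (0 : ℝ) < j := by exact_mod_cast hj
        have hdiv : ((2 ^ j / j ^ 3 : ℕ) : ℝ) ≤ 2 ^ j / (j : ℝ) ^ 3 := by
          refine Nat.cast_div_le.trans_eq ?_
          push_cast
          rfl
        have hpow : (j : ℝ) ^ (3 / 2 : ℝ) = j * √j := by
          rw [show (3 / 2 : ℝ) = 1 + 1 / 2 by norm_num, Real.rpow_add hj', Real.rpow_one,
            ← Real.sqrt_eq_rpow]
        have hsq : √(j : ℝ) * √j = j := Real.mul_self_sqrt hj'.le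
        have hs : 0 < √(j : ℝ) := Real.sqrt_pos.2 hj'
        calc ((j * j.sqrt : ℕ) : ℝ) / 2 ^ j * (2 ^ j / j ^ 3 : ℕ)
            ≤ (j * √j) / 2 ^ j * (2 ^ j / (j : ℝ) ^ 3) := by
              push_cast
              gcongr
              exact Real.nat_sqrt_le_real_sqrt
          _ = 1 / (j : ℝ) ^ (3 / 2 : ℝ) := by
              rw [hpow]
              field_simp
              nlinarith
    _ = ENNReal.ofReal (∑' j : ℕ, 1 / (j : ℝ) ^ (3 / 2 : ℝ)) :=
        (ENNReal.ofReal_tsum_of_nonneg (fun j => by positivity) hsum).symm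
    _ ≤ ENNReal.ofReal (D + 1 : ℕ) := ENNReal.ofReal_le_ofReal (by push_cast; linarith)
    _ = (D + 1 : ℕ) := ENNReal.ofReal_natCast _

theorem tsum_jumpWeight_div_le (hA : ∀ t, A t ≤ 2 ^ t) (hA' : ∀ t, 2 * A t ≤ A (t + 1)) :
    ∑' t, (jumpWeight A t : ℝ≥0∞) / 2 ^ t ≤
      ∑' j : ℕ, ((j * j.sqrt : ℕ) : ℝ≥0∞) / 2 ^ j * (2 ^ j / j ^ 3 : ℕ) := by
  calc ∑' t, (jumpWeight A t : ℝ≥0∞) / 2 ^ t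
      ≤ ∑' t, ∑' j : ℕ, ((j * j.sqrt : ℕ) : ℝ≥0∞) / 2 ^ j *
          ((level A j t - level A j (t - 1) : ℕ) : ℝ≥0∞) :=
        ENNReal.tsum_le_tsum fun t => (jumpWeight_div A t).trans_le (ENNReal.sum_le_tsum _)
    _ = ∑' j : ℕ, ((j * j.sqrt : ℕ) : ℝ≥0∞) / 2 ^ j *
          ∑' t, ((level A j t - level A j (t - 1) : ℕ) : ℝ≥0∞) := by
        rw [ENNReal.tsum_comm]
        simp only [ENNReal.tsum_mul_left]
    _ ≤ _ := by
        gcongr with j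
        exact tsum_level_sub_le hA hA' j

theorem computable_level (hA : Computable A) : Computable₂ (level A) := by
  have hle : Computable fun p : ℕ × ℕ => decide (p.1 ≤ p.2) := Primrec.nat_le.decide.to_comp
  have hcube : Computable fun n : ℕ => n ^ 3 :=
    (Primrec.nat_mul.to_comp.comp (Primrec.nat_mul.to_comp.comp Computable.id Computable.id)
      Computable.id).of_eq fun n => by simp only [id]; ring
  have hdiv : Computable fun p : ℕ × ℕ => A p.2 * 2 ^ p.1 / (2 ^ p.2 * p.1 ^ 3) :=
    Primrec.nat_div.to_comp.comp
      (Primrec.nat_mul.to_comp.comp (hA.comp Computable.snd)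
        (Computable.nat_two_pow.comp Computable.fst))
      (Primrec.nat_mul.to_comp.comp (Computable.nat_two_pow.comp Computable.snd)
        (hcube.comp Computable.fst))
  exact (Computable.cond hle hdiv (Computable.const 0)).of_eq fun p => Bool.cond_decide _ _ _

theorem computable_jumpWeight (hA : Computable A) : Computable (jumpWeight A) := by
  have hcoef : Computable fun p : ℕ × ℕ => p.2 * p.2.sqrt * 2 ^ (p.1 - p.2) :=
    Primrec.nat_mul.to_comp.comp
      (Primrec.nat_mul.to_comp.comp Computable.snd (Primrec.nat_sqrt.to_comp.comp Computable.snd))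
      (Computable.nat_two_pow.comp (Primrec.nat_sub.to_comp.comp Computable.fst Computable.snd))
  have hdiff : Computable fun p : ℕ × ℕ => level A p.2 p.1 - level A p.2 (p.1 - 1) :=
    Primrec.nat_sub.to_comp.comp ((computable_level hA).comp Computable.snd Computable.fst)
      ((computable_level hA).comp Computable.snd (Computable.pred.comp Computable.fst))
  have hterm : Computable₂ fun t j : ℕ =>
      j * j.sqrt * 2 ^ (t - j) * (level A j t - level A j (t - 1)) :=
    Primrec.nat_mul.to_comp.comp hcoef hdiff
  exact Computable.sum_range Computable.succ hterm

end Levels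

section SupportMass

variable {m : List Bool → ℝ≥0∞} {mt : List Bool → ℕ → ℚ} {f : ℕ → ℕ} {g : List Bool × ℕ → ℕ}

theorem two_mul_qval_le_of_one_lt_etest (hmt : IsApproxFromBelow m mt) {x : List Bool} {t : ℕ}
    (hx : 1 < etest mt f g x)
    (ht : ENNReal.ofReal (6 * Real.logb 2 x.length / x.length) < qval (mt (zeros t) (f t))) :
    2 * qval (mt x t) ≤ m x := by
  rw [etest] at hx
  split_ifs at hx with h
  · exact ((h t).resolve_left ht.not_ge).trans (hmt.qval_le _ x)
  · exact absurd hx (lt_irrefl 1)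

theorem logb_two_lt_of_lt_two_pow {n k : ℕ} (hn : 0 < n) (h : n < 2 ^ k) :
    Real.logb 2 n < k := by
  rw [Real.logb_lt_iff_lt_rpow one_lt_two (by exact_mod_cast hn), Real.rpow_natCast]
  exact_mod_cast h

theorem le_logb_two_of_two_pow_le {n k : ℕ} (h : 2 ^ k ≤ n) : (k : ℝ) ≤ Real.logb 2 n := by
  have hn : 0 < n := (Nat.two_pow_pos k).trans_le h
  rw [Real.le_logb_iff_rpow_le one_lt_two (by exact_mod_cast hn), Real.rpow_natCast]
  exact_mod_cast h

theorem threshold_lt_of_le_mul {K j n : ℕ} {q : ℝ≥0∞} (hj : (12 * K + 1) ^ 2 ≤ j)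
    (hn : 2 ^ j ≤ n) (hn' : n < 2 ^ (j + 1))
    (h : ((j * j.sqrt : ℕ) : ℝ≥0∞) / 2 ^ j ≤ K * q) :
    ENNReal.ofReal (6 * Real.logb 2 n / n) < q := by
  have hj0 : 0 < j := lt_of_lt_of_le (by positivity) hj
  have hsqrt : 12 * K + 1 ≤ j.sqrt := Nat.le_sqrt'.2 hj
  have hlog : Real.logb 2 n < (j + 1 : ℕ) :=
    logb_two_lt_of_lt_two_pow ((Nat.two_pow_pos j).trans_le hn) hn'
  have hthr : 6 * Real.logb 2 n / n ≤ (12 * j : ℕ) / 2 ^ j := by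
    have hj1 : (1 : ℝ) ≤ j := by exact_mod_cast hj0
    have hpow : (2 : ℝ) ^ j ≤ n := by exact_mod_cast hn
    push_cast at hlog ⊢
    exact div_le_div₀ (by positivity) (by linarith) (by positivity) hpow
  by_contra! hq
  have hle : ((j * j.sqrt : ℕ) : ℝ≥0∞) / 2 ^ j ≤ ((K * (12 * j) : ℕ) : ℝ≥0∞) / 2 ^ j := by
    refine h.trans ?_
    rw [Nat.cast_mul, mul_div_assoc, natCast_div_two_pow]
    gcongr
    exact hq.trans (ENNReal.ofReal_le_ofReal hthr)
  rw [ENNReal.div_le_iff (by simp) (by simp), ENNReal.div_mul_cancel (by simp) (by simp),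
    Nat.cast_le] at hle
  nlinarith

theorem tsum_one_lt_etest_le_of_large (hmt : IsApproxFromBelow m mt) (hm : IsSemimeasure m)
    {K : ℕ}
    (hK : ∀ t, (jumpWeight (stageMass mt) t : ℝ≥0∞) / 2 ^ t ≤ K * qval (mt (zeros t) (f t)))
    {j n : ℕ} (hj : (12 * K + 1) ^ 2 ≤ j) (hn : 2 ^ j ≤ n) (hn' : n < 2 ^ (j + 1)) :
    ∑' x : {x : List Bool // x.length = n ∧ 1 < etest mt f g x}, m x.1 ≤
      2 * ENNReal.ofReal (j ^ 3 / 2 ^ j) := by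
  have hj0 : 0 < j := lt_of_lt_of_le (by positivity) hj
  rcases level_eq_zero_or_exists_last_jump (stageMass_le hmt hm) (two_mul_stageMass_le hmt) j with
    h | ⟨t, hjt, hjump, hlast⟩
  · refine (tsum_subtype_le_of_stageMass_le hmt ?_ _).trans
      (le_mul_of_one_le_left zero_le one_le_two)
    filter_upwards [Filter.eventually_ge_atTop j] with s hs
    exact div_two_pow_le_of_level_eq_zero hj0 hs (h s)
  · refine tsum_subtype_le_two_mul hmt hm
      (fun s hs => div_two_pow_le_add_of_level_eq hj0 (hjt.trans hs) (hlast s hs)) _ ?_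
    rintro x ⟨rfl, hx⟩
    exact two_mul_qval_le_of_one_lt_etest hmt hx
      (threshold_lt_of_le_mul hj hn hn' ((le_jumpWeight_div hjt hjump).trans (hK t)))

theorem exists_stage_jumpWeight_le (hm : IsUniversalSemimeasure m)
    (hmt : IsApproxFromBelow m mt) :
    ∃ f : ℕ → ℕ, Computable f ∧ ∃ K : ℕ, ∀ t,
      (jumpWeight (stageMass mt) t : ℝ≥0∞) / 2 ^ t ≤ K * qval (mt (zeros t) (f t)) := by
  obtain ⟨D, hD0, hD⟩ := exists_tsum_scale_weights_le
  have hb (t : ℕ) : ((D * 2 ^ t - 1 + 1 : ℕ) : ℝ≥0∞) = D * 2 ^ t := by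
    rw [Nat.sub_add_cancel (Nat.mul_pos hD0 (Nat.two_pow_pos t))]
    push_cast
    rfl
  have hDne : (D : ℝ≥0∞) ≠ 0 := by exact_mod_cast hD0.ne'
  have hweight (t : ℕ) : (jumpWeight (stageMass mt) t : ℝ≥0∞) / (D * 2 ^ t) =
      (D : ℝ≥0∞)⁻¹ * ((jumpWeight (stageMass mt) t : ℝ≥0∞) / 2 ^ t) := by
    rw [div_eq_mul_inv, div_eq_mul_inv, ENNReal.mul_inv (Or.inl hDne) (Or.inl (by simp))]
    ring
  have hden : Computable fun t => D * 2 ^ t - 1 :=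
    Computable.pred.comp (Primrec.nat_mul.to_comp.comp (Computable.const D) Computable.nat_two_pow)
  obtain ⟨f, hf, c, -, hfc⟩ := exists_computable_stage hm hmt
    (computable_jumpWeight (computable_stageMass hmt)) hden (by
      simp only [hb, hweight]
      rw [ENNReal.tsum_mul_left]
      calc (D : ℝ≥0∞)⁻¹ * ∑' t, (jumpWeight (stageMass mt) t : ℝ≥0∞) / 2 ^ t
          ≤ (D : ℝ≥0∞)⁻¹ * D := by
            gcongr
            exact (tsum_jumpWeight_div_le (stageMass_le hmt hm.1)
              (two_mul_stageMass_le hmt)).trans hD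
        _ = 1 := ENNReal.inv_mul_cancel hDne (by simp))
  refine ⟨f, hf, D * c, fun t => ?_⟩
  have h := hfc t
  rw [hb, hweight, ENNReal.inv_mul_le_iff hDne (by simp)] at h
  rwa [Nat.cast_mul, mul_assoc]

end SupportMass

/-- The measure bound in the proof of Proposition 1: for some computable `f` and constant
`C > 0`, for every computable `g` and every `n ≥ 2`, the `m`-measure of the strings of
length `n` on which `e_{f,g}` exceeds `1` is at most `C (log n)³ / n`. -/
theorem etest_support_has_small_measure
    (m : List Bool → ℝ≥0∞) (mt : List Bool → ℕ → ℚ)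
    (hm : IsUniversalSemimeasure m) (hmt : IsApproxFromBelow m mt) :
    ∃ f : ℕ → ℕ, Computable f ∧ ∃ C : ℝ, 0 < C ∧
      ∀ g : List Bool × ℕ → ℕ, Computable g → ∀ n : ℕ, 2 ≤ n →
        ∑' x : {x : List Bool // x.length = n ∧ 1 < etest mt f g x}, m x.1 ≤
          ENNReal.ofReal (C * (Real.logb 2 n) ^ 3 / n) := by
  obtain ⟨f, hf, K, hK⟩ := exists_stage_jumpWeight_le hm hmt
  refine ⟨f, hf, 2 ^ (12 * K + 1) ^ 2 + 4, by positivity, fun g _ n hn => ?_⟩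
  have hn0 : n ≠ 0 := by omega
  have hn0' : (0 : ℝ) < n := by exact_mod_cast Nat.pos_of_ne_zero hn0
  have hle : 2 ^ Nat.log 2 n ≤ n := Nat.pow_log_le_self 2 hn0
  have hlt : n < 2 ^ (Nat.log 2 n + 1) := Nat.lt_pow_succ_log_self one_lt_two n
  have hlog : (Nat.log 2 n : ℝ) ≤ Real.logb 2 n := le_logb_two_of_two_pow_le hle
  generalize Nat.log 2 n = j at hle hlt hlog
  have hlog0 : 0 ≤ Real.logb 2 n := (Nat.cast_nonneg j).trans hlog
  rcases le_or_gt ((12 * K + 1) ^ 2) j with hj | hj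
  · refine (tsum_one_lt_etest_le_of_large hmt hm.1 hK hj hle hlt).trans ?_
    rw [← ENNReal.ofReal_ofNat, ← ENNReal.ofReal_mul zero_le_two]
    refine ENNReal.ofReal_le_ofReal ?_
    have hlt' : (n : ℝ) ≤ 2 * 2 ^ j := by
      rw [← pow_succ']
      exact_mod_cast hlt.le
    calc 2 * ((j : ℝ) ^ 3 / 2 ^ j) = 4 * (j : ℝ) ^ 3 / (2 * 2 ^ j) := by ring
      _ ≤ 4 * Real.logb 2 n ^ 3 / n := by gcongr
      _ ≤ (2 ^ (12 * K + 1) ^ 2 + 4) * Real.logb 2 n ^ 3 / n := by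
        gcongr
        exact le_add_of_nonneg_left (by positivity)
  · have hn1 : (n : ℝ) ≤ 2 ^ (12 * K + 1) ^ 2 + 4 := by
      have : n ≤ 2 ^ (12 * K + 1) ^ 2 :=
        hlt.le.trans (Nat.pow_le_pow_right two_pos hj)
      have h' : (n : ℝ) ≤ 2 ^ (12 * K + 1) ^ 2 := by exact_mod_cast this
      linarith
    have hlog1 : 1 ≤ Real.logb 2 n := by
      have h := le_logb_two_of_two_pow_le (n := n) (k := 1) (by simpa using hn)
      simpa using h
    refine ((ENNReal.tsum_comp_le_tsum_of_injective Subtype.val_injective m).trans hm.1).trans ?_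
    rw [← ENNReal.ofReal_one]
    refine ENNReal.ofReal_le_ofReal ?_
    rw [one_le_div hn0']
    exact hn1.trans (le_mul_of_one_le_right (by positivity) (one_le_pow₀ hlog1))
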